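/- arXiv:1008.3443 — 4 statements merged into one kernel-verified Lean document; each statement's English description precedes it below -/
import Mathlib

section
/- Let 𝒞 be a partition of V, let C, C' ∈ 𝒞 be distinct, and let 𝒟 = (𝒞∖{C,C'}) ∪ {C∪C'} be the partition obtained by merging C and C'. Then for any t > 0, Q_t(𝒟) = Q_t(𝒞) + 2·μ_t(C×C'). -/
open Finset

variable {V : Type*} [Fintype V] [DecidableEq V]

noncomputable section

/-- `Z = ∑_{l,r} m(l,r)` as a real number. -/
def Zval (m : V → V → ℕ) : ℝ := ∑ l : V, ∑ r : V, (m l r : ℝ)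

/-- The probability measure `m_E` on `V × V`. -/
def mE (m : V → V → ℕ) (S : Finset (V × V)) : ℝ :=
  (∑ p ∈ S, (m p.1 p.2 : ℝ)) / Zval m

/-- The marginal probability `m_V` on `V`. -/
def mV (m : V → V → ℕ) (A : Finset V) : ℝ := mE m (A ×ˢ Finset.univ)

/-- The product measure `m_VV` on `V × V`. -/
def mVV (m : V → V → ℕ) (S : Finset (V × V)) : ℝ :=
  ∑ p ∈ S, mV m {p.1} * mV m {p.2}

/-- The signed measure `μ_t = m_E - t · m_VV`. -/
def mu (m : V → V → ℕ) (t : ℝ) (S : Finset (V × V)) : ℝ := mE m S - t * mVV m S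

/-- `ρ(C) = m_E(C × (V ∖ C))`. -/
def rho (m : V → V → ℕ) (C : Finset V) : ℝ := mE m (C ×ˢ (Finset.univ \ C))

/-- A partition of `V`: pairwise disjoint nonempty sets covering `V`. -/
def IsPartition (𝒞 : Finset (Finset V)) : Prop :=
  (∀ C ∈ 𝒞, C.Nonempty) ∧
  (∀ C ∈ 𝒞, ∀ C' ∈ 𝒞, C ≠ C' → Disjoint C C') ∧
  𝒞.sup id = Finset.univ

/-- The diagonal set `D(𝒞) = ∪_{C ∈ 𝒞} C × C`. -/
def Dset (𝒞 : Finset (Finset V)) : Finset (V × V) := 𝒞.sup fun C => C ×ˢ C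

/-- The modularity at resolution `t`: `Q_t(𝒞) = μ_t(D(𝒞))`. -/
def Qmod (m : V → V → ℕ) (t : ℝ) (𝒞 : Finset (Finset V)) : ℝ := mu m t (Dset 𝒞)

/-- The complement `Q̄_t(𝒞) = μ_t(D̄(𝒞))`. -/
def Qbar (m : V → V → ℕ) (t : ℝ) (𝒞 : Finset (Finset V)) : ℝ :=
  mu m t (Finset.univ \ Dset 𝒞)

/-- `𝒞` is submodular for `μ_t`: `μ_t(C × C') ≤ 0` for distinct `C, C' ∈ 𝒞`. -/
def Submodular (m : V → V → ℕ) (t : ℝ) (𝒞 : Finset (Finset V)) : Prop :=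
  ∀ C ∈ 𝒞, ∀ C' ∈ 𝒞, C ≠ C' → mu m t (C ×ˢ C') ≤ 0

/-- `Coarsens 𝒞 𝒟` means `𝒞 ⪯ 𝒟`, i.e. `𝒟` refines `𝒞`:
every element of `𝒞` is the union of the elements of `𝒟` it contains. -/
def Coarsens (𝒞 𝒟 : Finset (Finset V)) : Prop :=
  ∀ C ∈ 𝒞, C = (𝒟.filter fun D => D ⊆ C).sup id

/-- The resolution `t(𝒞)`: the maximum of `m_E(C×C') / m_VV(C×C')` over distinct
pairs of parts (`0` when there are no such pairs, e.g. `|𝒞| = 1`). -/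
def resol (m : V → V → ℕ) (𝒞 : Finset (Finset V)) : ℝ :=
  ⨆ p : {p : Finset V × Finset V // p.1 ∈ 𝒞 ∧ p.2 ∈ 𝒞 ∧ p.1 ≠ p.2},
    mE m ((p : Finset V × Finset V).1 ×ˢ (p : Finset V × Finset V).2) /
      mVV m ((p : Finset V × Finset V).1 ×ˢ (p : Finset V × Finset V).2)

/-- The graph `G` associated to `m`: an edge between `l ≠ r` iff `m(l,r) > 0`
(for symmetric `m` this is exactly the graph of the paper). -/
def graphOf (m : V → V → ℕ) : SimpleGraph V :=
  SimpleGraph.fromRel fun l r => 0 < m l r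

/-- `α(𝒞) = m_VV(D(𝒞)) = ∑_{C ∈ 𝒞} m_V(C)²`. -/
def alphaP (m : V → V → ℕ) (𝒞 : Finset (Finset V)) : ℝ := mVV m (Dset 𝒞)

open scoped Classical in
/-- `Z₀(𝒞)` at resolution `t`: the pairs of distinct parts with `μ_t(C × C') = 0`. -/
def Z0 (m : V → V → ℕ) (t : ℝ) (𝒞 : Finset (Finset V)) :
    Finset (Finset V × Finset V) :=
  (𝒞 ×ˢ 𝒞).filter fun p => p.1 ≠ p.2 ∧ mu m t (p.1 ×ˢ p.2) = 0

/-- The value `c*` of the minimum cut of `G` with weights `m`. -/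
def mincut (m : V → V → ℕ) : ℝ :=
  ⨅ S : {S : Finset V // S.Nonempty ∧ S ≠ Finset.univ},
    ∑ l ∈ (S : Finset V), ∑ r ∈ Finset.univ \ (S : Finset V), (m l r : ℝ)

end

theorem mE_union (m : V → V → ℕ) {S T : Finset (V × V)} (h : Disjoint S T) :
    mE m (S ∪ T) = mE m S + mE m T := by
  rw [mE, mE, mE, sum_union h, add_div]

theorem mVV_union (m : V → V → ℕ) {S T : Finset (V × V)} (h : Disjoint S T) :
    mVV m (S ∪ T) = mVV m S + mVV m T := by
  rw [mVV, mVV, mVV, sum_union h]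

theorem mu_union (m : V → V → ℕ) (t : ℝ) {S T : Finset (V × V)} (h : Disjoint S T) :
    mu m t (S ∪ T) = mu m t S + mu m t T := by
  rw [mu, mu, mu, mE_union m h, mVV_union m h]
  ring

theorem mE_product_comm (m : V → V → ℕ) (hsym : ∀ l r, m l r = m r l) (A B : Finset V) :
    mE m (A ×ˢ B) = mE m (B ×ˢ A) := by
  rw [mE, mE, sum_product, sum_product_right]
  simp only [hsym]

theorem mVV_product_comm (m : V → V → ℕ) (A B : Finset V) :
    mVV m (A ×ˢ B) = mVV m (B ×ˢ A) := by
  rw [mVV, mVV, sum_product, sum_product_right]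
  simp only [mul_comm]

theorem mu_product_comm (m : V → V → ℕ) (hsym : ∀ l r, m l r = m r l) (t : ℝ)
    (A B : Finset V) : mu m t (A ×ˢ B) = mu m t (B ×ˢ A) := by
  rw [mu, mu, mE_product_comm m hsym, mVV_product_comm]

theorem mem_Dset {𝒞 : Finset (Finset V)} {p : V × V} :
    p ∈ Dset 𝒞 ↔ ∃ D ∈ 𝒞, p.1 ∈ D ∧ p.2 ∈ D := by
  simp [Dset, Finset.mem_sup]

theorem Dset_merge {𝒞 : Finset (Finset V)} {C C' : Finset V} (hC : C ∈ 𝒞) (hC' : C' ∈ 𝒞) :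
    Dset (insert (C ∪ C') (𝒞 \ {C, C'})) = Dset 𝒞 ∪ (C ×ˢ C' ∪ C' ×ˢ C) := by
  ext ⟨a, b⟩
  simp only [mem_Dset, mem_union, mem_product, mem_insert, mem_sdiff, mem_singleton]
  constructor
  · rintro ⟨D, rfl | ⟨hD, -⟩, ha, hb⟩
    · grind
    · exact Or.inl ⟨D, hD, ha, hb⟩
  · rintro (⟨D, hD, ha, hb⟩ | h)
    · by_cases h : D = C ∨ D = C'
      · exact ⟨C ∪ C', Or.inl rfl, by grind⟩
      · exact ⟨D, Or.inr ⟨hD, h⟩, ha, hb⟩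
    · exact ⟨C ∪ C', Or.inl rfl, by grind⟩

theorem IsPartition.disjoint_Dset_product {𝒞 : Finset (Finset V)} (h𝒞 : IsPartition 𝒞)
    {C C' : Finset V} (hC : C ∈ 𝒞) (hC' : C' ∈ 𝒞) (hne : C ≠ C') :
    Disjoint (Dset 𝒞) (C ×ˢ C') := by
  rw [disjoint_left]
  rintro ⟨a, b⟩ hab h
  obtain ⟨D, hD, ha, hb⟩ := mem_Dset.1 hab
  obtain ⟨haC, hbC'⟩ := mem_product.1 h
  have eq_of_mem : ∀ E ∈ 𝒞, ∀ x ∈ D, x ∈ E → D = E := fun E hE x hxD hxE => by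
    by_contra hDE
    exact disjoint_left.1 (h𝒞.2.1 D hD E hE hDE) hxD hxE
  exact hne ((eq_of_mem C hC a ha haC).symm.trans (eq_of_mem C' hC' b hb hbC'))

/-- Merging two distinct parts `C, C'` of a partition `𝒞` into
`𝒟 = (𝒞∖{C,C'}) ∪ {C∪C'}` gives `Q_t(𝒟) = Q_t(𝒞) + 2·μ_t(C×C')` for any `t > 0`. -/
theorem stmt_2 (m : V → V → ℕ) (hsym : ∀ l r, m l r = m r l)
    (hZ : 0 < ∑ l : V, ∑ r : V, m l r) (hdeg : ∀ l : V, 0 < ∑ r : V, m l r)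
    (𝒞 : Finset (Finset V)) (h𝒞 : IsPartition 𝒞)
    (C C' : Finset V) (hC : C ∈ 𝒞) (hC' : C' ∈ 𝒞) (hne : C ≠ C')
    (𝒟 : Finset (Finset V)) (h𝒟 : 𝒟 = insert (C ∪ C') (𝒞 \ {C, C'}))
    (t : ℝ) (ht : 0 < t) :
    Qmod m t 𝒟 = Qmod m t 𝒞 + 2 * mu m t (C ×ˢ C') := by
  have hprod : Disjoint (C ×ˢ C') (C' ×ˢ C) :=
    disjoint_product.2 (Or.inl (h𝒞.2.1 C hC C' hC' hne))
  have hdiag : Disjoint (Dset 𝒞) (C ×ˢ C' ∪ C' ×ˢ C) :=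
    disjoint_union_right.2 ⟨h𝒞.disjoint_Dset_product hC hC' hne,
      h𝒞.disjoint_Dset_product hC' hC hne.symm⟩
  rw [h𝒟, Qmod, Qmod, Dset_merge hC hC', mu_union m t hdiag, mu_union m t hprod,
    mu_product_comm m hsym t C' C]
  ring
end

section
/- If 0 < t ≤ 1 and the partition 𝒞* of V is submodular for μ_t, then 𝒞* is positive for μ_t, i.e. μ_t(C×C) ≥ 0 for every C ∈ 𝒞*. -/
open Finset

variable {V : Type*} [Fintype V] [DecidableEq V]

/-- The signed measure `μ_t` as a sum of its point masses over a product set. -/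
lemma mu_product (m : V → V → ℕ) (t : ℝ) (A B : Finset V) :
    mu m t (A ×ˢ B) =
      ∑ r ∈ B, ∑ l ∈ A, ((m l r : ℝ) / Zval m - t * (mV m {l} * mV m {r})) := by
  simp only [mu, mE, mVV, Finset.sum_div, Finset.mul_sum, ← Finset.sum_sub_distrib]
  exact Finset.sum_product_right _ _ _

lemma mu_product_univ_eq_sum (m : V → V → ℕ) (t : ℝ) {𝒞 : Finset (Finset V)}
    (h𝒞 : IsPartition 𝒞) (A : Finset V) :
    mu m t (A ×ˢ Finset.univ) = ∑ C ∈ 𝒞, mu m t (A ×ˢ C) := by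
  simp only [mu_product]
  rw [← h𝒞.2.2, Finset.sup_eq_biUnion, Finset.sum_biUnion]
  · simp only [id]
  · exact fun C hC C' hC' hne => h𝒞.2.1 C hC C' hC' hne

lemma mV_nonneg (m : V → V → ℕ) (A : Finset V) : 0 ≤ mV m A := by
  unfold mV mE Zval
  positivity

lemma mV_eq_sum (m : V → V → ℕ) (A : Finset V) : mV m A = ∑ l ∈ A, mV m {l} := by
  simp only [mV, mE, Finset.sum_product, Finset.sum_singleton, Finset.sum_div]

lemma mV_univ (m : V → V → ℕ) (hZ : Zval m ≠ 0) : mV m Finset.univ = 1 := by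
  rw [mV, mE, Finset.sum_product]
  exact div_self hZ

lemma mu_product_univ (m : V → V → ℕ) (hZ : Zval m ≠ 0) (t : ℝ) (A : Finset V) :
    mu m t (A ×ˢ Finset.univ) = (1 - t) * mV m A := by
  have h : mVV m (A ×ˢ Finset.univ) = mV m A := by
    rw [mVV, Finset.sum_product]
    simp only [← Finset.mul_sum, ← mV_eq_sum, mV_univ m hZ, mul_one]
  rw [mu, h, mV]
  ring

/-- If `0 < t ≤ 1` and the partition `𝒞*` of `V` is submodular for
`μ_t`, then `𝒞*` is positive for `μ_t`: `μ_t(C×C) ≥ 0` for every `C ∈ 𝒞*`. -/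
theorem stmt_4 (m : V → V → ℕ) (hsym : ∀ l r, m l r = m r l)
    (hZ : 0 < ∑ l : V, ∑ r : V, m l r) (hdeg : ∀ l : V, 0 < ∑ r : V, m l r)
    (t : ℝ) (ht : 0 < t) (ht1 : t ≤ 1)
    (𝒞s : Finset (Finset V)) (h𝒞s : IsPartition 𝒞s) (hsub : Submodular m t 𝒞s) :
    ∀ C ∈ 𝒞s, 0 ≤ mu m t (C ×ˢ C) := by
  intro C hC
  have hZ' : Zval m ≠ 0 := by
    have : (0 : ℝ) < Zval m := by
      unfold Zval
      exact_mod_cast hZ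
    exact this.ne'
  have hrow := mu_product_univ_eq_sum m t h𝒞s C
  rw [mu_product_univ m hZ' t C, ← Finset.add_sum_erase _ _ hC] at hrow
  have hoff : ∑ C' ∈ 𝒞s.erase C, mu m t (C ×ˢ C') ≤ 0 :=
    Finset.sum_nonpos fun C' hC' =>
      hsub C hC C' (Finset.mem_of_mem_erase hC') (Finset.ne_of_mem_erase hC').symm
  have hnonneg := mul_nonneg (sub_nonneg.mpr ht1) (mV_nonneg m C)
  linarith
end

section
/- Let 𝒞 be a partition of V and t > 0. Then Q_t(𝒞) ≤ m_E(D(𝒞))·(1 − 2t·min_{C∈𝒞} ρ(C)). -/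
open Finset

variable {V : Type*} [Fintype V] [DecidableEq V]

lemma Zval_nonneg (m : V → V → ℕ) : 0 ≤ Zval m := by
  unfold Zval
  positivity

lemma mE_nonneg (m : V → V → ℕ) (S : Finset (V × V)) : 0 ≤ mE m S :=
  div_nonneg (by positivity) (Zval_nonneg m)

lemma mE_biUnion {ι : Type*} [DecidableEq ι] (m : V → V → ℕ) (s : Finset ι)
    (f : ι → Finset (V × V)) (hf : (s : Set ι).PairwiseDisjoint f) :
    mE m (s.biUnion f) = ∑ i ∈ s, mE m (f i) := by
  unfold mE
  rw [Finset.sum_biUnion hf, Finset.sum_div]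

lemma mVV_biUnion {ι : Type*} [DecidableEq ι] (m : V → V → ℕ) (s : Finset ι)
    (f : ι → Finset (V × V)) (hf : (s : Set ι).PairwiseDisjoint f) :
    mVV m (s.biUnion f) = ∑ i ∈ s, mVV m (f i) :=
  Finset.sum_biUnion hf

lemma mV_eq_sum_singleton (m : V → V → ℕ) (A : Finset V) : mV m A = ∑ a ∈ A, mV m {a} := by
  simp only [mV, mE, Finset.sum_product, Finset.sum_singleton, Finset.sum_div]

lemma mVV_product (m : V → V → ℕ) (A B : Finset V) : mVV m (A ×ˢ B) = mV m A * mV m B := by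
  rw [mV_eq_sum_singleton m A, mV_eq_sum_singleton m B, Finset.sum_mul_sum, mVV,
    Finset.sum_product]

lemma mV_eq_mE_add_rho (m : V → V → ℕ) (C : Finset V) :
    mV m C = mE m (C ×ˢ C) + rho m C := by
  simp only [mV, rho, mE, Finset.sum_product, ← add_div, ← Finset.sum_add_distrib]
  congr 1
  refine Finset.sum_congr rfl fun x _ => ?_
  rw [add_comm, Finset.sum_sdiff (Finset.subset_univ C)]

lemma two_mul_mE_mul_rho_le (m : V → V → ℕ) (C : Finset V) :
    2 * mE m (C ×ˢ C) * rho m C ≤ mVV m (C ×ˢ C) := by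
  rw [mVV_product, mV_eq_mE_add_rho]
  nlinarith [sq_nonneg (mE m (C ×ˢ C)), sq_nonneg (rho m C)]

lemma IsPartition.pairwiseDisjoint_product {𝒞 : Finset (Finset V)} (h : IsPartition 𝒞) :
    (𝒞 : Set (Finset V)).PairwiseDisjoint fun C => C ×ˢ C :=
  fun C hC C' hC' hne => Finset.disjoint_product.2 (Or.inl (h.2.1 C hC C' hC' hne))

lemma IsPartition.two_mul_mE_Dset_mul_iInf_rho_le (m : V → V → ℕ) {𝒞 : Finset (Finset V)}
    (h : IsPartition 𝒞) :
    2 * mE m (Dset 𝒞) * (⨅ C : 𝒞, rho m (C : Finset V)) ≤ mVV m (Dset 𝒞) := by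
  rw [Dset, Finset.sup_eq_biUnion, mE_biUnion m _ _ h.pairwiseDisjoint_product,
    mVV_biUnion m _ _ h.pairwiseDisjoint_product, Finset.mul_sum, Finset.sum_mul]
  refine Finset.sum_le_sum fun C hC => le_trans ?_ (two_mul_mE_mul_rho_le m C)
  exact mul_le_mul_of_nonneg_left
    (ciInf_le (Set.finite_range fun C : 𝒞 => rho m (C : Finset V)).bddBelow ⟨C, hC⟩)
    (mul_nonneg zero_le_two (mE_nonneg m _))

/-- For a partition `𝒞` of `V` and `t > 0`,
`Q_t(𝒞) ≤ m_E(D(𝒞))·(1 − 2t·min_{C∈𝒞} ρ(C))`. -/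
theorem stmt_9 (m : V → V → ℕ) (hsym : ∀ l r, m l r = m r l)
    (hZ : 0 < ∑ l : V, ∑ r : V, m l r) (hdeg : ∀ l : V, 0 < ∑ r : V, m l r)
    (𝒞 : Finset (Finset V)) (h𝒞 : IsPartition 𝒞) (t : ℝ) (ht : 0 < t) :
    Qmod m t 𝒞 ≤ mE m (Dset 𝒞) * (1 - 2 * t * ⨅ C : 𝒞, rho m (C : Finset V)) := by
  have h := mul_le_mul_of_nonneg_left (h𝒞.two_mul_mE_Dset_mul_iInf_rho_le m) ht.le
  unfold Qmod mu
  linarith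
end

section
/- If the partition 𝒞 of V is submodular for μ_t (with t > 0), then Q_t(𝒞) ≥ 1 − t; in particular, if t ≤ 1, then Q_t(𝒞) ≥ 0. -/
open Finset

variable {V : Type*} [Fintype V] [DecidableEq V]

omit [DecidableEq V] in
/-- `μ_t` as a sum of its values on points. -/
lemma mu_eq_sum (m : V → V → ℕ) (t : ℝ) (S : Finset (V × V)) :
    mu m t S = ∑ p ∈ S, ((m p.1 p.2 : ℝ) / Zval m - t * (mV m {p.1} * mV m {p.2})) := by
  rw [mu, mE, mVV, Finset.sum_sub_distrib, Finset.sum_div, Finset.mul_sum]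

lemma mu_univ_sdiff (m : V → V → ℕ) (t : ℝ) (S : Finset (V × V)) :
    mu m t (Finset.univ \ S) + mu m t S = mu m t Finset.univ := by
  simp only [mu_eq_sum]
  exact Finset.sum_sdiff (Finset.subset_univ S)

omit [DecidableEq V] in
lemma mE_univ (m : V → V → ℕ) (hZ : Zval m ≠ 0) : mE m Finset.univ = 1 := by
  rw [mE, Fintype.sum_prod_type]
  exact div_self hZ

omit [DecidableEq V] in
lemma mV_singleton (m : V → V → ℕ) (l : V) : mV m {l} = (∑ r : V, (m l r : ℝ)) / Zval m := by
  rw [mV, mE, Finset.sum_product, Finset.sum_singleton]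

omit [DecidableEq V] in
lemma sum_mV_singleton (m : V → V → ℕ) (hZ : Zval m ≠ 0) : ∑ l : V, mV m {l} = 1 := by
  simp only [mV_singleton]
  rw [← Finset.sum_div]
  exact div_self hZ

omit [DecidableEq V] in
lemma mVV_univ (m : V → V → ℕ) (hZ : Zval m ≠ 0) : mVV m Finset.univ = 1 := by
  rw [mVV, Fintype.sum_prod_type]
  dsimp only
  rw [← Finset.sum_mul_sum, sum_mV_singleton m hZ, mul_one]

omit [DecidableEq V] in
lemma mu_univ (m : V → V → ℕ) (t : ℝ) (hZ : Zval m ≠ 0) : mu m t Finset.univ = 1 - t := by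
  rw [mu, mE_univ m hZ, mVV_univ m hZ, mul_one]

lemma IsPartition.exists_mem {𝒞 : Finset (Finset V)} (h : IsPartition 𝒞) (v : V) :
    ∃ C ∈ 𝒞, v ∈ C := by
  have hv : v ∈ 𝒞.sup id := h.2.2 ▸ Finset.mem_univ v
  simpa [Finset.mem_sup] using hv

lemma IsPartition.eq_of_mem {𝒞 : Finset (Finset V)} (h : IsPartition 𝒞) {C C' : Finset V}
    (hC : C ∈ 𝒞) (hC' : C' ∈ 𝒞) {v : V} (hv : v ∈ C) (hv' : v ∈ C') : C = C' := by
  by_contra hne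
  exact Finset.disjoint_left.mp (h.2.1 C hC C' hC' hne) hv hv'

lemma IsPartition.univ_sdiff_Dset {𝒞 : Finset (Finset V)} (h : IsPartition 𝒞) :
    Finset.univ \ Dset 𝒞 = 𝒞.offDiag.biUnion fun q => q.1 ×ˢ q.2 := by
  ext ⟨l, r⟩
  simp only [Dset, Finset.mem_sdiff, Finset.mem_univ, true_and, Finset.mem_sup,
    Finset.mem_product, Finset.mem_biUnion, Finset.mem_offDiag, Prod.exists]
  constructor
  · intro hlr
    obtain ⟨C, hC, hl⟩ := h.exists_mem l
    obtain ⟨C', hC', hr⟩ := h.exists_mem r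
    exact ⟨C, C', ⟨hC, hC', fun e => hlr ⟨C, hC, hl, e ▸ hr⟩⟩, hl, hr⟩
  · rintro ⟨C, C', ⟨hC, hC', hne⟩, hl, hr⟩ ⟨B, hB, hlB, hrB⟩
    exact hne ((h.eq_of_mem hC hB hl hlB).trans (h.eq_of_mem hB hC' hrB hr))

lemma IsPartition.Qbar_eq_sum {𝒞 : Finset (Finset V)} (h : IsPartition 𝒞) (m : V → V → ℕ)
    (t : ℝ) : Qbar m t 𝒞 = ∑ q ∈ 𝒞.offDiag, mu m t (q.1 ×ˢ q.2) := by
  rw [Qbar, h.univ_sdiff_Dset, mu_eq_sum, Finset.sum_biUnion]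
  · simp only [mu_eq_sum]
  · intro q hq q' hq' hne
    simp only [Finset.mem_coe, Finset.mem_offDiag] at hq hq'
    refine Finset.disjoint_left.mpr fun p hp hp' => hne ?_
    rw [Finset.mem_product] at hp hp'
    exact Prod.ext (h.eq_of_mem hq.1 hq'.1 hp.1 hp'.1) (h.eq_of_mem hq.2.1 hq'.2.1 hp.2 hp'.2)

lemma Submodular.Qbar_nonpos {m : V → V → ℕ} {t : ℝ} {𝒞 : Finset (Finset V)}
    (hsub : Submodular m t 𝒞) (h : IsPartition 𝒞) : Qbar m t 𝒞 ≤ 0 := by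
  rw [h.Qbar_eq_sum]
  refine Finset.sum_nonpos fun q hq => ?_
  rw [Finset.mem_offDiag] at hq
  exact hsub q.1 hq.1 q.2 hq.2.1 hq.2.2

/-- If the partition `𝒞` of `V` is submodular for `μ_t` (`t > 0`),
then `Q_t(𝒞) ≥ 1 − t`; in particular, if `t ≤ 1` then `Q_t(𝒞) ≥ 0`. -/
theorem stmt_11 (m : V → V → ℕ) (hsym : ∀ l r, m l r = m r l)
    (hZ : 0 < ∑ l : V, ∑ r : V, m l r) (hdeg : ∀ l : V, 0 < ∑ r : V, m l r)
    (𝒞 : Finset (Finset V)) (h𝒞 : IsPartition 𝒞) (t : ℝ) (ht : 0 < t)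
    (hsub : Submodular m t 𝒞) :
    1 - t ≤ Qmod m t 𝒞 ∧ (t ≤ 1 → 0 ≤ Qmod m t 𝒞) := by
  have hZ' : Zval m ≠ 0 := by
    have : (0 : ℝ) < Zval m := by
      unfold Zval
      exact_mod_cast hZ
    exact this.ne'
  have hsum : Qbar m t 𝒞 + Qmod m t 𝒞 = 1 - t :=
    (mu_univ_sdiff m t (Dset 𝒞)).trans (mu_univ m t hZ')
  have hbar := hsub.Qbar_nonpos h𝒞
  exact ⟨by linarith, fun _ => by linarith⟩
end
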